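/- Let G be a minimal bipartite matching covered graph. Then the number of vertices of degree exactly 2 in G is at least n/2 + 2, i.e. 2·|V2| ≥ n + 4, where n is the number of vertices of G. -/

import Mathlib

open SimpleGraph

/-- The degree of a vertex `v` in a graph `G`: the number of neighbours of `v`. -/
noncomputable def degN {V : Type*} (G : SimpleGraph V) (v : V) : ℕ :=
  (G.neighborSet v).ncard

/-- A finite simple graph is matching covered if it is connected, has at least 4 vertices,
and every edge lies in some perfect matching. -/
def MatchingCovered {V : Type*} [Fintype V] (G : SimpleGraph V) : Prop :=
  G.Connected ∧ 4 ≤ Fintype.card V ∧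
    ∀ e ∈ G.edgeSet, ∃ M : G.Subgraph, M.IsPerfectMatching ∧ e ∈ M.edgeSet

/-- A matching covered graph is minimal if deleting any edge destroys the property. -/
def MinimalMatchingCovered {V : Type*} [Fintype V] (G : SimpleGraph V) : Prop :=
  MatchingCovered G ∧ ∀ e ∈ G.edgeSet, ¬ MatchingCovered (G.deleteEdges {e})

section TightSets

open Finset
open scoped Classical

variable {α β : Type*}

/-- The elements related to some member of `D`. -/
noncomputable def relNbrs [Fintype α] (r : α → β → Prop) (D : Finset β) : Finset α :=
  {a | ∃ b ∈ D, r a b}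

/-- The elements to which `a` is related. -/
noncomputable def relImage [Fintype β] (r : α → β → Prop) (a : α) : Finset β :=
  {b | r a b}

variable {r : α → β → Prop}

theorem mem_relNbrs [Fintype α] {D : Finset β} {a : α} : a ∈ relNbrs r D ↔ ∃ b ∈ D, r a b := by
  simp [relNbrs]

theorem mem_relImage [Fintype β] {a : α} {b : β} : b ∈ relImage r a ↔ r a b := by
  simp [relImage]

theorem relNbrs_union [Fintype α] (D E : Finset β) :
    relNbrs r (D ∪ E) = relNbrs r D ∪ relNbrs r E := by
  ext a
  simp only [mem_relNbrs, mem_union]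
  grind

theorem relNbrs_inter_subset [Fintype α] (D E : Finset β) :
    relNbrs r (D ∩ E) ⊆ relNbrs r D ∩ relNbrs r E := by
  intro a
  simp only [mem_relNbrs, mem_inter]
  grind

theorem exists_relImage_avoiding_pair [Fintype β] {a : α}
    (ha : 3 ≤ (relImage r a).card) (b b' : β) :
    ∃ c, r a c ∧ c ≠ b ∧ c ≠ b' := by
  have h : ¬ relImage r a ⊆ {b, b'} := by
    intro h
    have := card_le_card h
    have := card_le_two (a := b) (b := b')
    omega
  obtain ⟨c, hc, hc'⟩ := not_subset.1 h
  simp only [mem_insert, mem_singleton, not_or] at hc'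
  exact ⟨c, mem_relImage.1 hc, hc'⟩

/-- `W` is a union of connected components of the hypergraph with edges `relImage r a`,
`a ∈ T`. -/
def Saturated (r : α → β → Prop) (T : Finset α) (W : Set β) : Prop :=
  ∀ a ∈ T, ∀ u v, r a u → r a v → u ∈ W → v ∈ W

/-- The hypergraph with edges `relImage r a`, `a ∈ T`, has the component count of a
hyperforest. -/
def HyperforestCount [Fintype β] (r : α → β → Prop) (T : Finset α) : Prop :=
  ∃ f : β → β, (∀ W, Saturated r T W → ∀ b b', f b = f b' → b ∈ W → b' ∈ W) ∧
    ∑ a ∈ T, (relImage r a).card + (univ.image f).card ≤ Fintype.card β + T.card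

theorem HyperforestCount.empty [Fintype β] : HyperforestCount r ∅ :=
  ⟨id, fun W _ b b' h hb => by rwa [← show b = b' from h], by simp [card_univ]⟩

theorem HyperforestCount.insert [Fintype β] {T : Finset α} {a : α} (haT : a ∉ T)
    (hT : HyperforestCount r T) (hne : (relImage r a).Nonempty)
    (hsep : ∀ b b', r a b → r a b' → b ≠ b' →
      ∃ W, Saturated r T W ∧ (b ∈ W ∧ b' ∉ W ∨ b' ∈ W ∧ b ∉ W)) :
    HyperforestCount r (insert a T) := by
  obtain ⟨f, hf, hcard⟩ := hT
  obtain ⟨b₀, hb₀⟩ := hne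
  have hinj : Set.InjOn f (relImage r a) := by
    intro b hb b' hb' h
    by_contra hbb
    obtain ⟨W, hW, ⟨h1, h2⟩ | ⟨h1, h2⟩⟩ :=
      hsep b b' (mem_relImage.1 hb) (mem_relImage.1 hb') hbb
    · exact h2 (hf W hW _ _ h h1)
    · exact h2 (hf W hW _ _ h.symm h1)
  have himg := card_image_of_injOn hinj
  refine ⟨fun b => if f b ∈ (relImage r a).image f then f b₀ else f b, ?_, ?_⟩
  · intro W hW b b' h hb
    have hWT : Saturated r T W := fun c hc => hW c (mem_insert_of_mem hc)
    have hWa := hW a (mem_insert_self a T)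
    have hb₀' := mem_image_of_mem f hb₀
    dsimp only at h
    by_cases h1 : f b ∈ (relImage r a).image f <;>
      by_cases h2 : f b' ∈ (relImage r a).image f
    · obtain ⟨x, hx, hxb⟩ := mem_image.1 h1
      obtain ⟨y, hy, hyb⟩ := mem_image.1 h2
      exact hf W hWT _ _ hyb (hWa x y (mem_relImage.1 hx) (mem_relImage.1 hy)
        (hf W hWT _ _ hxb.symm hb))
    · rw [if_pos h1, if_neg h2] at h
      exact absurd (h ▸ hb₀') h2
    · rw [if_neg h1, if_pos h2] at h
      exact absurd (h ▸ hb₀') h1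
    · rw [if_neg h1, if_neg h2] at h
      exact hf W hWT _ _ h hb
  · have hsub : univ.image (fun b => if f b ∈ (relImage r a).image f then f b₀ else f b) ⊆
        Insert.insert (f b₀) (univ.image f \ (relImage r a).image f) := by
      intro y
      simp only [mem_image, mem_insert, mem_sdiff, mem_univ, true_and]
      rintro ⟨b, rfl⟩
      by_cases h : ∃ x ∈ relImage r a, f x = f b
      · exact Or.inl (if_pos h)
      · exact Or.inr (by rw [if_neg h]; exact ⟨⟨b, rfl⟩, h⟩)
    have h1 := (card_le_card hsub).trans (card_insert_le _ _)
    have h2 := card_sdiff_add_card_eq_card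
      (image_subset_image (f := f) (subset_univ (relImage r a)))
    rw [sum_insert haT, card_insert_of_notMem haT]
    omega

variable [Fintype α] [Fintype β]

/-- Every nonempty proper subset of `β` has more neighbours than elements. -/
def StrictHall (r : α → β → Prop) : Prop :=
  ∀ D : Finset β, D.Nonempty → D ≠ univ → D.card + 1 ≤ (relNbrs r D).card

/-- A proper tight set containing `b` and meeting the neighbourhood of `a` only in `b`. -/
def IsBranch (r : α → β → Prop) (a : α) (b : β) (D : Finset β) : Prop :=
  b ∈ D ∧ D ≠ univ ∧ (relNbrs r D).card = D.card + 1 ∧ ∀ b' ∈ D, r a b' → b' = b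

/-- Branches at `a` along distinct edges have only `a` as a common neighbour. -/
theorem IsBranch.eq_of_mem_relNbrs (hr : StrictHall r) {a : α} {b b' : β} {D D' : Finset β}
    (ha : 3 ≤ (relImage r a).card) (hab : r a b) (hab' : r a b') (hbb : b ≠ b')
    (hD : IsBranch r a b D) (hD' : IsBranch r a b' D') {c : α}
    (hc : c ∈ relNbrs r D) (hc' : c ∈ relNbrs r D') : c = a := by
  obtain ⟨hb, -, hcard, hD⟩ := hD
  obtain ⟨hb', -, hcard', hD'⟩ := hD'
  have huniv : D ∪ D' ≠ univ := by
    intro h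
    obtain ⟨x, hx, hxb, hxb'⟩ := exists_relImage_avoiding_pair ha b b'
    have : x ∈ D ∪ D' := h ▸ mem_univ x
    grind
  have hun := hr (D ∪ D') ⟨b, by simp [hb]⟩ huniv
  rw [relNbrs_union] at hun
  have h1 := card_union_add_card_inter (relNbrs r D) (relNbrs r D')
  have h2 := card_union_add_card_inter D D'
  have haa : a ∈ relNbrs r D ∩ relNbrs r D' := by
    simp only [mem_inter, mem_relNbrs]
    exact ⟨⟨b, hb, hab⟩, ⟨b', hb', hab'⟩⟩
  rcases (D ∩ D').eq_empty_or_nonempty with hemp | hne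
  · rw [hemp, card_empty] at h2
    have h3 : (relNbrs r D ∩ relNbrs r D').card ≤ 1 := by omega
    exact card_le_one.1 h3 c (mem_inter.2 ⟨hc, hc'⟩) a haa
  · have hin := hr (D ∩ D') hne (by
      intro h
      apply huniv
      rw [eq_univ_iff_forall] at h ⊢
      intro x
      have := h x
      grind)
    have h3 : a ∉ relNbrs r (D ∩ D') := by
      rw [mem_relNbrs]
      rintro ⟨x, hx, hax⟩
      rw [mem_inter] at hx
      exact hbb ((hD x hx.1 hax).symm.trans (hD' x hx.2 hax))
    have h4 := card_le_card (insert_subset haa (relNbrs_inter_subset (r := r) D D'))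
    rw [card_insert_of_notMem h3] at h4
    omega

/-- A branch at `a` absorbs any branch of another vertex that it touches and that avoids `a`. -/
theorem IsBranch.union (hr : StrictHall r) {a c : α} {b b' : β} {D E : Finset β}
    (ha : 3 ≤ (relImage r a).card) (hcb : r c b')
    (hD : IsBranch r a b D) (hE : IsBranch r c b' E)
    (hc : c ∈ relNbrs r D) (haE : a ∉ relNbrs r E) : IsBranch r a b (D ∪ E) := by
  obtain ⟨hb, hDu, hcard, hD⟩ := hD
  obtain ⟨hb', hEu, hcard', hE⟩ := hE
  have haE' : ∀ x ∈ E, ¬ r a x := fun x hx h => haE (mem_relNbrs.2 ⟨x, hx, h⟩)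
  have huniv : D ∪ E ≠ univ := by
    intro h
    obtain ⟨x, hx, hxb, -⟩ := exists_relImage_avoiding_pair ha b b
    have : x ∈ D ∪ E := h ▸ mem_univ x
    grind
  refine ⟨by simp [hb], huniv, ?_, by grind⟩
  have hun := hr (D ∪ E) ⟨b, by simp [hb]⟩ huniv
  rw [relNbrs_union] at hun ⊢
  have h1 := card_union_add_card_inter (relNbrs r D) (relNbrs r E)
  have h2 := card_union_add_card_inter D E
  rcases (D ∩ E).eq_empty_or_nonempty with hemp | hne
  · rw [hemp, card_empty] at h2
    have h3 : 0 < (relNbrs r D ∩ relNbrs r E).card :=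
      card_pos.2 ⟨c, mem_inter.2 ⟨hc, mem_relNbrs.2 ⟨b', hb', hcb⟩⟩⟩
    omega
  · have hin := hr (D ∩ E) hne (by
      intro h
      apply huniv
      rw [eq_univ_iff_forall] at h ⊢
      intro x
      have := h x
      grind)
    have h4 := card_le_card (relNbrs_inter_subset (r := r) D E)
    omega

/-- A branch that is inclusion-maximal among those at `a` along `b`. -/
def IsMaxBranch (r : α → β → Prop) (a : α) (b : β) (D : Finset β) : Prop :=
  IsBranch r a b D ∧ ∀ E, IsBranch r a b E → D ⊆ E → E = D

theorem IsBranch.exists_isMaxBranch {a : α} {b : β} {D : Finset β} (h : IsBranch r a b D) :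
    ∃ E, IsMaxBranch r a b E := by
  obtain ⟨E, hE, hmax⟩ := exists_max_image ({E | IsBranch r a b E} : Finset (Finset β)) card
    ⟨D, by simpa using h⟩
  simp only [mem_filter, mem_univ, true_and] at hE hmax
  exact ⟨E, hE, fun F hF hEF => (eq_of_subset_of_card_le hEF (hmax F hF)).symm⟩

/-- A maximal branch at `a` along `b` contains the part of the incidence structure on
vertices of degree at least three that hangs off `a` through `b`. -/
theorem IsMaxBranch.exists_separating (hr : StrictHall r)
    (hbr : ∀ a b, r a b → ∃ D, IsBranch r a b D) (n : ℕ) :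
    ∀ (a : α) (b : β) (D : Finset β), D.card ≤ n → 3 ≤ (relImage r a).card → r a b →
      IsMaxBranch r a b D → ∃ (P : Set α) (Q : Set β), b ∈ Q ∧ a ∉ P ∧
        (∀ u ∈ P, u ∈ relNbrs r D) ∧ (∀ v ∈ Q, v ∈ D) ∧
        ∀ u v, 3 ≤ (relImage r u).card → u ≠ a → r u v → (u ∈ P ↔ v ∈ Q) := by
  induction n with
  | zero =>
    intro a b D hn _ _ hD
    have := card_pos.2 ⟨b, hD.1.1⟩
    omega
  | succ n ih =>
    intro a b D hn ha hab hD
    have haD : a ∈ relNbrs r D := mem_relNbrs.2 ⟨b, hD.1.1, hab⟩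
    let bad (c : α) : Prop :=
      3 ≤ (relImage r c).card ∧ c ∈ relNbrs r D ∧ c ≠ a ∧ ∃ b₂, b₂ ∉ D ∧ r c b₂
    have key : ∀ c b₁, bad c ∧ b₁ ∈ D ∧ r c b₁ → ∃ (P : Set α) (Q : Set β), b₁ ∈ Q ∧ c ∉ P ∧
        b ∉ Q ∧
        ∀ u v, 3 ≤ (relImage r u).card → u ≠ c → r u v → (u ∈ P ↔ v ∈ Q) := by
      rintro c b₁ ⟨⟨hc3, hcD, hca, b₂, hb₂, hcb₂⟩, hb₁, hcb₁⟩
      have absorb : ∀ b' E, r c b' → IsBranch r c b' E → a ∉ relNbrs r E → E ⊆ D := by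
        intro b' E hcb' hE haE
        have := hD.2 _ (hD.1.union hr ha hcb' hE hcD haE) subset_union_left
        exact this ▸ subset_union_right
      obtain ⟨E₂, hE₂⟩ := hbr c b₂ hcb₂
      obtain ⟨E₁, hE₁⟩ := (hbr c b₁ hcb₁).elim fun _ h => h.exists_isMaxBranch
      have haE₂ : a ∈ relNbrs r E₂ := by
        by_contra h
        exact hb₂ (absorb b₂ E₂ hcb₂ hE₂ h hE₂.1)
      have haE₁ : a ∉ relNbrs r E₁ := by
        intro h
        have hne : b₁ ≠ b₂ := fun h => hb₂ (h ▸ hb₁)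
        exact hca (IsBranch.eq_of_mem_relNbrs hr hc3 hcb₁ hcb₂ hne hE₁.1 hE₂ h haE₂).symm
      have hsub := absorb b₁ E₁ hcb₁ hE₁.1 haE₁
      have hlt : E₁.card < D.card :=
        card_lt_card (hsub.ssubset_of_ne fun h => haE₁ (h ▸ haD))
      obtain ⟨P, Q, h1, h2, h3, h4, h5⟩ := ih c b₁ E₁ (by omega) hc3 hcb₁ hE₁
      refine ⟨P, Q, h1, h2, fun hbQ => haE₁ (h3 a ?_), h5⟩
      exact (h5 a b ha hca.symm hab).2 hbQ
    choose! P Q hQ hP hbQ hPQ using key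
    refine ⟨{u | u ∈ relNbrs r D ∧ u ≠ a ∧ ¬ bad u ∧
        ∀ c b₁, bad c ∧ b₁ ∈ D ∧ r c b₁ → u ∉ P c b₁},
      {v | v ∈ D ∧ ∀ c b₁, bad c ∧ b₁ ∈ D ∧ r c b₁ → v ∉ Q c b₁},
      ⟨hD.1.1, hbQ⟩, fun h => h.2.1 rfl, fun u hu => hu.1, fun v hv => hv.1, ?_⟩
    intro u v hu hua huv
    constructor
    · rintro ⟨h1, -, h3, h4⟩
      refine ⟨?_, fun c b₁ hc hv => h4 c b₁ hc ?_⟩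
      · by_contra hv
        exact h3 ⟨hu, h1, hua, v, hv, huv⟩
      · exact (hPQ c b₁ hc u v hu (fun h => h3 (h ▸ hc.1)) huv).2 hv
    · rintro ⟨h1, h2⟩
      have hnb : ¬ bad u := fun h => h2 u v ⟨h, h1, huv⟩ (hQ u v ⟨h, h1, huv⟩)
      refine ⟨mem_relNbrs.2 ⟨v, h1, huv⟩, hua, hnb, fun c b₁ hc huP => h2 c b₁ hc ?_⟩
      exact (hPQ c b₁ hc u v hu (fun h => hnb (h ▸ hc.1)) huv).1 huP

/-- In a strictly Hall relation in which every pair lies on a branch, the elements of degree at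
least three, together with at most one further element, form a hyperforest. -/
theorem hyperforestCount_of_branches (hr : StrictHall r)
    (hbr : ∀ a b, r a b → ∃ D, IsBranch r a b D) (T X : Finset α)
    (hT : ∀ a ∈ T, 3 ≤ (relImage r a).card)
    (hX : X.card ≤ 1) (hTX : Disjoint T X) (hXne : ∀ x ∈ X, (relImage r x).Nonempty) :
    HyperforestCount r (T ∪ X) := by
  induction T using Finset.induction_on with
  | empty =>
    rw [empty_union]
    rcases X.eq_empty_or_nonempty with rfl | ⟨x, hx⟩
    · exact HyperforestCount.empty
    · obtain rfl : X = {x} :=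
        eq_singleton_iff_unique_mem.2 ⟨hx, fun y hy => card_le_one.1 hX y hy x hx⟩
      refine HyperforestCount.empty.insert (notMem_empty x) (hXne x hx) fun b b' _ _ h =>
        ⟨{b}, fun a ha => absurd ha (notMem_empty a), Or.inl ⟨rfl, fun h' => h h'.symm⟩⟩
  | insert a S haS ih =>
    rw [disjoint_insert_left] at hTX
    rw [insert_union]
    have ha := hT a (mem_insert_self a S)
    have hS : ∀ c ∈ S, 3 ≤ (relImage r c).card := fun c hc => hT c (mem_insert_of_mem hc)
    refine (ih hS hTX.2).insert (by simp [haS, hTX.1]) (card_pos.1 (by omega)) ?_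
    have hsat : ∀ b b' D, r a b → r a b' → b ≠ b' → IsMaxBranch r a b D →
        (∀ x ∈ X, x ∉ relNbrs r D) → ∃ W, Saturated r (S ∪ X) W ∧ b ∈ W ∧ b' ∉ W := by
      intro b b' D hab hab' hbb hD hx
      obtain ⟨P, Q, h1, -, -, h4, h5⟩ :=
        IsMaxBranch.exists_separating hr hbr _ a b D le_rfl ha hab hD
      refine ⟨Q, ?_, h1, fun h => hbb (hD.1.2.2.2 b' (h4 b' h) hab').symm⟩
      intro c hc u v hcu hcv hu
      rcases mem_union.1 hc with hc | hc
      · have hca : c ≠ a := fun h => haS (h ▸ hc)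
        exact (h5 c v (hS c hc) hca hcv).1 ((h5 c u (hS c hc) hca hcu).2 hu)
      · exact absurd (mem_relNbrs.2 ⟨u, h4 u hu, hcu⟩) (hx c hc)
    intro b b' hab hab' hbb
    obtain ⟨D, hD⟩ := (hbr a b hab).elim fun _ h => h.exists_isMaxBranch
    obtain ⟨D', hD'⟩ := (hbr a b' hab').elim fun _ h => h.exists_isMaxBranch
    by_cases hx : ∀ x ∈ X, x ∉ relNbrs r D
    · obtain ⟨W, hW, h1, h2⟩ := hsat b b' D hab hab' hbb hD hx
      exact ⟨W, hW, Or.inl ⟨h1, h2⟩⟩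
    · push Not at hx
      obtain ⟨x, hxX, hxD⟩ := hx
      obtain ⟨W, hW, h1, h2⟩ := hsat b' b D' hab' hab hbb.symm hD' (by
        intro y hy hyD'
        obtain rfl : x = y := card_le_one.1 hX x hxX y hy
        exact hTX.1 (IsBranch.eq_of_mem_relNbrs hr ha hab hab' hbb hD.1 hD'.1 hxD hyD' ▸ hy))
      exact ⟨W, hW, Or.inr ⟨h1, h2⟩⟩

theorem card_degree_ge_three_add_two_le (hr : StrictHall r)
    (hbr : ∀ a b, r a b → ∃ D, IsBranch r a b D) (hcard : Fintype.card α = Fintype.card β)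
    (hα : 2 ≤ Fintype.card α) (hdeg : ∀ a, 2 ≤ (relImage r a).card) :
    ({a | (relImage r a).card ≠ 2} : Finset α).card + 2 ≤
      ({a | (relImage r a).card = 2} : Finset α).card := by
  set T : Finset α := {a | (relImage r a).card ≠ 2} with hTdef
  set S : Finset α := {a | (relImage r a).card = 2} with hSdef
  have hT : ∀ a ∈ T, 3 ≤ (relImage r a).card := by
    intro a ha
    have h1 : (relImage r a).card ≠ 2 := by simpa [hTdef] using ha
    have := hdeg a
    omega
  have hST : S.card + T.card = Fintype.card α :=
    card_filter_add_card_filter_not (s := univ) (fun a => (relImage r a).card = 2)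
  have hdisj : Disjoint T S := by
    rw [Finset.disjoint_left]
    intro a h1 h2
    simp only [hTdef, hSdef, mem_filter] at h1 h2
    exact h1.2 h2.2
  have : Nonempty β := Fintype.card_pos_iff.1 (by omega)
  have key : ∀ X ⊆ S, X.card ≤ 1 → T.card + X.card + 1 ≤ S.card := by
    intro X hXS hX
    have hTX := disjoint_of_subset_right hXS hdisj
    obtain ⟨f, -, hf⟩ := hyperforestCount_of_branches hr hbr T X hT hX hTX
      fun x _ => card_pos.1 (by have := hdeg x; omega)
    rw [sum_union hTX, card_union_of_disjoint hTX] at hf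
    have h1 := card_nsmul_le_sum T (fun a => (relImage r a).card) 3 hT
    have h2 := card_nsmul_le_sum X (fun a => (relImage r a).card) 2 fun a _ => hdeg a
    have h3 : 0 < (univ.image f).card := card_pos.2 (univ_nonempty.image f)
    simp only [smul_eq_mul] at h1 h2
    omega
  have h0 := key ∅ (empty_subset S) (by simp)
  obtain ⟨x, hx⟩ : S.Nonempty := card_pos.1 (by omega)
  have h1 := key {x} (by simpa using hx) (by simp)
  rw [card_singleton] at h1
  omega

end TightSets

section Bipartite

open Finset
open scoped Classical

variable {V : Type*} {G : SimpleGraph V} {C : V → Bool}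

/-- Adjacency between the two classes of a two-colouring. -/
def crossAdj (G : SimpleGraph V) (C : V → Bool) (a : {v // C v = true})
    (b : {v // C v = false}) : Prop :=
  G.Adj a b

theorem SimpleGraph.Subgraph.IsPerfectMatching.exists_mate {M : G.Subgraph}
    (hM : M.IsPerfectMatching) : ∃ f : V → V, Function.Injective f ∧
      (∀ v, G.Adj v (f v)) ∧ ∀ u v, M.Adj u v → f u = v := by
  rw [Subgraph.isPerfectMatching_iff] at hM
  choose f hf hf' using hM
  refine ⟨f, fun u v h => ?_, fun v => (hf v).adj_sub, fun u v h => (hf' u v h).symm⟩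
  have h1 : M.Adj (f v) u := h ▸ (hf u).symm
  exact (hf' _ _ h1).trans (hf' _ _ (hf v).symm).symm

theorem SimpleGraph.Connected.exists_adj_boundary (hG : G.Connected) (K : Set V) {x y : V}
    (hx : x ∈ K) (hy : y ∉ K) : ∃ u v, G.Adj u v ∧ u ∈ K ∧ v ∉ K := by
  obtain ⟨w⟩ := hG.preconnected x y
  obtain ⟨d, -, h1, h2⟩ := w.exists_boundary_dart K hx hy
  exact ⟨d.fst, d.snd, d.adj, h1, h2⟩

variable [Fintype V]

theorem two_mul_card_true_class (h : Fintype.card {v // C v = true} =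
    Fintype.card {v // C v = false}) :
    2 * Fintype.card {v // C v = true} = Fintype.card V := by
  have h1 := Fintype.card_subtype_compl (fun v => C v = true)
  have h2 : Fintype.card {v // ¬ C v = true} = Fintype.card {v // C v = false} :=
    Fintype.card_congr (Equiv.subtypeEquivRight fun v => by simp)
  have h3 := Fintype.card_subtype_le (fun v => C v = true)
  omega

theorem MatchingCovered.card_classes_eq (hC : ∀ u v, G.Adj u v → C u ≠ C v)
    (hG : MatchingCovered G) :
    Fintype.card {v // C v = true} = Fintype.card {v // C v = false} := by
  obtain ⟨hconn, hcard, hM⟩ := hG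
  have : Nontrivial V := Fintype.one_lt_card_iff_nontrivial.1 (by omega)
  obtain ⟨u⟩ := hconn.nonempty
  obtain ⟨v, huv⟩ := hconn.preconnected.exists_adj_of_nontrivial u
  obtain ⟨M, hM, -⟩ := hM s(u, v) huv
  obtain ⟨f, hinj, hadj, -⟩ := hM.exists_mate
  apply le_antisymm
  · refine Fintype.card_le_of_injective
      (fun a => ⟨f a, by have := hC _ _ (hadj a); grind⟩) fun a b h => ?_
    exact Subtype.ext (hinj (congrArg Subtype.val h))
  · refine Fintype.card_le_of_injective
      (fun a => ⟨f a, by have := hC _ _ (hadj a); grind⟩) fun a b h => ?_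
    exact Subtype.ext (hinj (congrArg Subtype.val h))

theorem MatchingCovered.strictHall (hC : ∀ u v, G.Adj u v → C u ≠ C v)
    (hG : MatchingCovered G) : StrictHall (crossAdj G C) := by
  intro D ⟨x, hx⟩ hD
  obtain ⟨y, hy⟩ : ∃ y, y ∉ D := by
    by_contra! h
    exact hD (eq_univ_iff_forall.2 h)
  obtain ⟨u, v, huv, hu, hv⟩ := hG.1.exists_adj_boundary
    {v | (∃ b ∈ D, (b : V) = v) ∨ ∃ a ∈ relNbrs (crossAdj G C) D, (a : V) = v}
    (x := x) (y := y) (Or.inl ⟨x, hx, rfl⟩) (by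
      rintro (⟨b, hb, h⟩ | ⟨a, ha, h⟩)
      · exact hy (Subtype.ext h ▸ hb)
      · have h1 := a.2
        have h2 := y.2
        rw [h, h2] at h1
        cases h1)
  have hCuv := hC u v huv
  obtain ⟨M, hM, hMuv⟩ := hG.2.2 s(u, v) huv
  obtain ⟨f, hinj, hadj, hfM⟩ := hM.exists_mate
  rcases hu with ⟨b, hb, rfl⟩ | ⟨a, ha, rfl⟩
  · exact absurd (Or.inr ⟨⟨v, by have := b.2; grind⟩, mem_relNbrs.2 ⟨b, hb, huv.symm⟩, rfl⟩) hv
  · have hCf : ∀ b : {v // C v = false}, C (f b) = true := by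
      intro b
      have := hC _ _ (hadj b)
      grind
    have h1 : insert a (D.image fun b => ⟨f b, hCf b⟩) ⊆ relNbrs (crossAdj G C) D := by
      refine insert_subset ha fun c hc => ?_
      obtain ⟨b, hb, rfl⟩ := mem_image.1 hc
      exact mem_relNbrs.2 ⟨b, hb, (hadj b).symm⟩
    have h2 := card_le_card h1
    rwa [card_insert_of_notMem, card_image_of_injective] at h2
    · intro b b' h
      exact Subtype.ext (hinj (congrArg Subtype.val h))
    · intro h
      obtain ⟨b, hb, h⟩ := mem_image.1 h
      have h3 : f v = a := hfM v a hMuv.symm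
      have h4 : (b : V) = v := hinj ((congrArg Subtype.val h).trans h3.symm)
      exact hv (Or.inl ⟨b, hb, h4⟩)

theorem StrictHall.exists_rel {α β : Type*} [Fintype α] [Fintype β] {r : α → β → Prop}
    (hr : StrictHall r) (hcard : Fintype.card α = Fintype.card β) (hβ : 2 ≤ Fintype.card β)
    (a : α) : ∃ b, r a b := by
  have : Nontrivial β := Fintype.one_lt_card_iff_nontrivial.1 hβ
  obtain ⟨b, b', hbb⟩ := exists_pair_ne β
  have h1 := hr (univ.erase b) ⟨b', by simp [hbb.symm]⟩ fun h => by
    have := mem_univ b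
    rw [← h] at this
    simp at this
  rw [card_erase_of_mem (mem_univ b), card_univ] at h1
  have h2 : relNbrs r (univ.erase b) = univ :=
    (card_eq_iff_eq_univ _).1 (le_antisymm (card_le_univ _) (by omega))
  obtain ⟨c, -, hc⟩ := mem_relNbrs.1 (h2 ▸ mem_univ a)
  exact ⟨c, hc⟩

/-- In a strictly Hall relation every related pair extends to a perfect matching. -/
theorem StrictHall.exists_injective {α β : Type*} [Fintype α] [Fintype β] {r : α → β → Prop}
    (hr : StrictHall r) {a : α} {b : β} (hab : r a b) :
    ∃ f : β → α, Function.Injective f ∧ (∀ x, r (f x) x) ∧ f b = a := by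
  let t : β → Finset α := fun x => if x = b then {a} else ({c | r c x} : Finset α).erase a
  have hsub : ∀ D : Finset β, b ∉ D → (relNbrs r D).erase a ⊆ D.biUnion t := by
    intro D hb c hc
    obtain ⟨hca, hc⟩ := mem_erase.1 hc
    obtain ⟨x, hx, hcx⟩ := mem_relNbrs.1 hc
    refine mem_biUnion.2 ⟨x, hx, ?_⟩
    have hxb : x ≠ b := fun h => hb (h ▸ hx)
    simp [t, hxb, hca, hcx]
  have hle : ∀ D : Finset β, b ∉ D → D.card ≤ ((relNbrs r D).erase a).card := by
    intro D hb
    rcases D.eq_empty_or_nonempty with rfl | hne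
    · simp
    · have h1 := hr D hne fun h => hb (h ▸ mem_univ b)
      have h2 := pred_card_le_card_erase (a := a) (s := relNbrs r D)
      omega
  obtain ⟨f, hf, hft⟩ := (all_card_le_biUnion_card_iff_exists_injective t).1 (by
    intro D
    by_cases hb : b ∈ D
    · have h1 := hle (D.erase b) (notMem_erase b D)
      have h2 := hsub (D.erase b) (notMem_erase b D)
      have h3 : insert a ((relNbrs r (D.erase b)).erase a) ⊆ D.biUnion t :=
        insert_subset (mem_biUnion.2 ⟨b, hb, by simp [t]⟩)
          (h2.trans (biUnion_subset_biUnion_of_subset_left t (erase_subset b D)))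
      have h4 := card_le_card h3
      rw [card_insert_of_notMem (notMem_erase _ _)] at h4
      have h5 := card_erase_add_one hb
      omega
    · exact (hle D hb).trans (card_le_card (hsub D hb)))
  have hfb : f b = a := by simpa [t] using hft b
  refine ⟨f, hf, fun x => ?_, hfb⟩
  by_cases hx : x = b
  · rw [hx, hfb]
    exact hab
  · have := hft x
    simp only [t, if_neg hx, mem_erase, mem_filter] at this
    exact this.2.2

theorem StrictHall.exists_isPerfectMatching (hr : StrictHall (crossAdj G C))
    (hcard : Fintype.card {v // C v = true} = Fintype.card {v // C v = false})
    {a b : V} (ha : C a = true) (hb : C b = false) (hab : G.Adj a b) :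
    ∃ M : G.Subgraph, M.IsPerfectMatching ∧ M.Adj a b := by
  obtain ⟨f, hf, hadj, hfb⟩ := hr.exists_injective (a := ⟨a, ha⟩) (b := ⟨b, hb⟩) hab
  have hsurj : Function.Surjective f :=
    ((Fintype.bijective_iff_injective_and_card f).2 ⟨hf, hcard.symm⟩).2
  let M : G.Subgraph :=
    { verts := Set.univ
      Adj := fun u v => ∃ x : {v // C v = false}, u = x ∧ v = f x ∨ v = x ∧ u = f x
      adj_sub := by
        rintro u v ⟨x, ⟨rfl, rfl⟩ | ⟨rfl, rfl⟩⟩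
        · exact (hadj x).symm
        · exact hadj x
      edge_vert := fun _ => Set.mem_univ _
      symm := ⟨fun u v ⟨x, h⟩ => ⟨x, h.symm⟩⟩ }
  have hne : ∀ (x : {v // C v = false}) (y : {v // C v = true}), (x : V) ≠ y := by
    intro x y h
    have h1 := x.2
    have h2 := y.2
    rw [h, h2] at h1
    cases h1
  refine ⟨M, Subgraph.isPerfectMatching_iff.2 fun v => ?_, ⟨⟨b, hb⟩, Or.inr ⟨rfl, by rw [hfb]⟩⟩⟩
  rcases hv : C v with _ | _
  · refine ⟨f ⟨v, hv⟩, ⟨⟨v, hv⟩, Or.inl ⟨rfl, rfl⟩⟩, ?_⟩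
    rintro w ⟨x, ⟨rfl, rfl⟩ | ⟨rfl, h⟩⟩
    · rfl
    · exact absurd h (hne ⟨v, hv⟩ (f x))
  · obtain ⟨x, hx⟩ := hsurj ⟨v, hv⟩
    have hx' : v = f x := by rw [hx]
    refine ⟨x, ⟨x, Or.inr ⟨rfl, hx'⟩⟩, ?_⟩
    rintro w ⟨y, ⟨h, -⟩ | ⟨rfl, h⟩⟩
    · exact absurd h.symm (hne y ⟨v, hv⟩)
    · exact congrArg Subtype.val (hf (Subtype.ext (h.symm.trans hx')))

theorem StrictHall.matchingCovered (hC : ∀ u v, G.Adj u v → C u ≠ C v)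
    (hr : StrictHall (crossAdj G C)) (hV : 4 ≤ Fintype.card V)
    (hcard : Fintype.card {v // C v = true} = Fintype.card {v // C v = false}) :
    MatchingCovered G := by
  have hhalf := two_mul_card_true_class hcard
  have : Nonempty V := Fintype.card_pos_iff.1 (by omega)
  refine ⟨⟨fun x y => ?_⟩, hV, ?_⟩
  · by_contra hxy
    let D : Finset {v // C v = false} := {b | G.Reachable x b}
    have hclosed : ∀ u v, G.Adj u v → (G.Reachable x u ↔ G.Reachable x v) := fun u v h =>
      ⟨fun h' => h'.trans h.reachable, fun h' => h'.trans h.symm.reachable⟩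
    have hnb := hr.exists_rel hcard (by omega)
    have hD : D.Nonempty := by
      rcases hx : C x with _ | _
      · exact ⟨⟨x, hx⟩, by simp [D]⟩
      · obtain ⟨b, hb⟩ := hnb ⟨x, hx⟩
        exact ⟨b, mem_filter.2 ⟨mem_univ b, SimpleGraph.Adj.reachable hb⟩⟩
    have hDc : Dᶜ.Nonempty := by
      rcases hy : C y with _ | _
      · exact ⟨⟨y, hy⟩, by simp [D, hxy]⟩
      · obtain ⟨b, hb⟩ := hnb ⟨y, hy⟩
        refine ⟨b, ?_⟩
        rw [mem_compl, mem_filter]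
        exact fun h => hxy ((hclosed y b hb).2 h.2)
    have h1 := hr D hD fun h => by simp [h] at hDc
    have h2 := hr Dᶜ hDc fun h => by simp [compl_eq_univ_iff] at h; simp [h] at hD
    have h3 : Disjoint (relNbrs (crossAdj G C) D) (relNbrs (crossAdj G C) Dᶜ) := by
      rw [Finset.disjoint_left]
      intro a ha ha'
      obtain ⟨b, hb, hab⟩ := mem_relNbrs.1 ha
      obtain ⟨b', hb', hab'⟩ := mem_relNbrs.1 ha'
      rw [mem_compl, mem_filter] at hb'
      rw [mem_filter] at hb
      exact hb' ⟨mem_univ _, (hclosed a b' hab').1 ((hclosed a b hab).2 hb.2)⟩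
    have h4 := card_le_univ (relNbrs (crossAdj G C) D ∪ relNbrs (crossAdj G C) Dᶜ)
    rw [card_union_of_disjoint h3] at h4
    have h5 := card_add_card_compl D
    omega
  · intro e he
    induction e with
    | _ u v =>
      have hCuv := hC u v he
      rcases hu : C u with _ | _
      · obtain ⟨M, hM, h⟩ :=
          hr.exists_isPerfectMatching hcard (a := v) (b := u) (by grind) hu he.symm
        exact ⟨M, hM, h.symm⟩
      · obtain ⟨M, hM, h⟩ :=
          hr.exists_isPerfectMatching hcard (a := u) (b := v) hu (by grind) he
        exact ⟨M, hM, h⟩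

theorem MinimalMatchingCovered.exists_isBranch (hC : ∀ u v, G.Adj u v → C u ≠ C v)
    (hG : MinimalMatchingCovered G) (a : {v // C v = true}) (b : {v // C v = false})
    (hab : crossAdj G C a b) : ∃ D, IsBranch (crossAdj G C) a b D := by
  have hr := hG.1.strictHall hC
  have hdel : ¬ StrictHall (crossAdj (G.deleteEdges {s((a : V), (b : V))}) C) := fun h =>
    hG.2 s((a : V), (b : V)) hab (h.matchingCovered
      (fun u v huv => hC u v (deleteEdges_le _ huv)) hG.1.2.1 (hG.1.card_classes_eq hC))
  set r' := crossAdj (G.deleteEdges {s((a : V), (b : V))}) C with hr'def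
  have hr' : ∀ x y, crossAdj G C x y → ¬ (x = a ∧ y = b) → r' x y := by
    intro x y hxy hne
    rw [hr'def, crossAdj, deleteEdges_adj]
    refine ⟨hxy, fun h => ?_⟩
    rw [Set.mem_singleton_iff, Sym2.eq_iff] at h
    rcases h with ⟨h1, h2⟩ | ⟨h1, -⟩
    · exact hne ⟨Subtype.ext h1, Subtype.ext h2⟩
    · have h2 := x.2
      rw [h1, b.2] at h2
      cases h2
  rw [StrictHall] at hdel
  push Not at hdel
  obtain ⟨D, hne, hD, hlt⟩ := hdel
  have h1 := hr D hne hD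
  have hb : b ∈ D := by
    by_contra hb
    have h2 : relNbrs (crossAdj G C) D ⊆ relNbrs r' D := by
      intro x hx
      obtain ⟨y, hy, hxy⟩ := mem_relNbrs.1 hx
      exact mem_relNbrs.2 ⟨y, hy, hr' x y hxy fun h => hb (h.2 ▸ hy)⟩
    have := card_le_card h2
    omega
  have h2 : relNbrs (crossAdj G C) D ⊆ insert a (relNbrs r' D) := by
    intro x hx
    obtain ⟨y, hy, hxy⟩ := mem_relNbrs.1 hx
    by_cases hxa : x = a
    · exact hxa ▸ mem_insert_self _ _
    · exact mem_insert_of_mem (mem_relNbrs.2 ⟨y, hy, hr' x y hxy fun h => hxa h.1⟩)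
  have h3 := card_le_card h2
  have h4 : a ∉ relNbrs r' D := by
    intro h
    rw [insert_eq_of_mem h] at h3
    omega
  rw [card_insert_of_notMem h4] at h3
  refine ⟨D, hb, hD, by omega, fun y hy hay => ?_⟩
  by_contra hyb
  exact h4 (mem_relNbrs.2 ⟨y, hy, hr' a y hay fun h => hyb h.2⟩)

theorem degN_eq_card_relImage (hC : ∀ u v, G.Adj u v → C u ≠ C v) (a : {v // C v = true}) :
    degN G a = (relImage (crossAdj G C) a).card := by
  rw [degN, ← card_map (Function.Embedding.subtype _), ← Set.ncard_coe_finset]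
  congr 1
  ext v
  simp only [mem_neighborSet, coe_map, Set.mem_image, mem_coe, mem_relImage, crossAdj,
    Function.Embedding.subtype_apply]
  constructor
  · intro h
    exact ⟨⟨v, by have := hC _ _ h; have := a.2; grind⟩, h, rfl⟩
  · rintro ⟨w, h, rfl⟩
    exact h

theorem ncard_true_class_eq (P : V → Prop) :
    {v | C v = true ∧ P v}.ncard =
      ({a : {v // C v = true} | P a} : Finset {v // C v = true}).card := by
  rw [← card_map (Function.Embedding.subtype _), ← Set.ncard_coe_finset]
  congr 1
  ext v
  simp [and_comm]

theorem MatchingCovered.two_le_degN (hG : MatchingCovered G)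
    (hC : ∀ u v, G.Adj u v → C u ≠ C v) (v : V) : 2 ≤ degN G v := by
  let C' : V → Bool := fun u => C u != C v
  have hC' : ∀ u w, G.Adj u w → C' u ≠ C' w := by
    intro u w h h'
    have := hC u w h
    simp only [C'] at h'
    revert this h'
    cases C u <;> cases C w <;> cases C v <;> simp
  have hcard := hG.card_classes_eq hC'
  have hhalf := two_mul_card_true_class hcard
  have hV := hG.2.1
  have h := hG.strictHall hC' {⟨v, by simp [C']⟩} (singleton_nonempty _) fun h => by
    have := congrArg card h
    rw [card_singleton, card_univ] at this
    omega
  rw [card_singleton, ← card_map (Function.Embedding.subtype _), ← Set.ncard_coe_finset] at h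
  refine h.trans (Set.ncard_le_ncard ?_ (Set.toFinite _))
  intro w hw
  simp only [coe_map, Set.mem_image, mem_coe, mem_relNbrs, mem_singleton] at hw
  obtain ⟨a, ⟨b, rfl, hab⟩, rfl⟩ := hw
  exact SimpleGraph.Adj.symm hab

theorem MinimalMatchingCovered.ncard_class_le (hC : ∀ u v, G.Adj u v → C u ≠ C v)
    (hG : MinimalMatchingCovered G) :
    {v | C v = true ∧ degN G v ≠ 2}.ncard + 2 ≤ {v | C v = true ∧ degN G v = 2}.ncard := by
  have hcard := hG.1.card_classes_eq hC
  have hhalf := two_mul_card_true_class hcard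
  have hV := hG.1.2.1
  have h := card_degree_ge_three_add_two_le (hG.1.strictHall hC) (hG.exists_isBranch hC) hcard
    (by omega) fun a => degN_eq_card_relImage hC a ▸ hG.1.two_le_degN hC a
  rw [ncard_true_class_eq, ncard_true_class_eq]
  simpa only [degN_eq_card_relImage hC] using h

end Bipartite

/-- A minimal bipartite matching covered graph has at least `n/2 + 2` vertices
of degree exactly 2. -/
theorem stmt2 {V : Type*} [Fintype V] (G : SimpleGraph V)
    (hbip : G.Colorable 2) (hmin : MinimalMatchingCovered G) :
    2 * {v | degN G v = 2}.ncard ≥ Fintype.card V + 4 := by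
  obtain ⟨c⟩ := hbip
  let C : V → Bool := fun v => decide (c v = 0)
  have hC : ∀ u v, G.Adj u v → C u ≠ C v := by
    intro u v h hCuv
    have h1 : c u ≠ c v := c.valid h
    have h2 : c u = 0 ↔ c v = 0 := by simpa [C] using hCuv
    omega
  have hC' : ∀ u v, G.Adj u v → (! C u) ≠ ! C v := fun u v h h' => hC u v h (by simpa using h')
  have h1 := hmin.ncard_class_le hC
  have h2 := hmin.ncard_class_le hC'
  have split : ∀ P : V → Prop,
      {v | P v}.ncard = {v | C v = true ∧ P v}.ncard + {v | (! C v) = true ∧ P v}.ncard := by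
    intro P
    rw [← Set.ncard_union_eq _ (Set.toFinite _) (Set.toFinite _)]
    · congr 1
      ext v
      cases h : C v <;> simp [h]
    · rw [Set.disjoint_left]
      rintro v ⟨h, -⟩ ⟨h', -⟩
      simp [h] at h'
  have h3 := split fun v => degN G v = 2
  have h4 := split fun v => degN G v ≠ 2
  have h5 := Set.ncard_add_ncard_compl {v | degN G v = 2}
  have h6 : {v | degN G v = 2}ᶜ = {v | degN G v ≠ 2} := rfl
  rw [h6, Nat.card_eq_fintype_card] at h5
  omega
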